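/- arXiv:2004.04767 — 2 statements merged into one kernel-verified Lean document; each statement's English description precedes it below -/
import Mathlib

section
/- Let (p_k)_{k∈ℕ} be nonnegative reals with p_0 = 0, 0 < p_1 < 1, and ∑_{k≥1} p_k = 1, and let G be the associated probability generating function. Then for all 0 < α ≤ β < 1, the path depth satisfies L_{β→α} ≤ min{ log(β/α)/log(β/G(β)) , log((1−α)/(1−β))/log((1−G(α))/(1−α)) } + 1. -/
/-- The probability generating function of a distribution `p` on ℕ. -/
noncomputable def pgf (p : ℕ → ℝ) (s : ℝ) : ℝ := ∑' k, p k * s ^ k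

/-- The path depth `L_{β→α}`: the minimum number of iterations of the PGF needed
to bring `β` at or below `α`. -/
noncomputable def pathDepth (p : ℕ → ℝ) (β α : ℝ) : ℕ :=
  sInf {L : ℕ | (pgf p)^[L] β ≤ α}

theorem summable_mul_pow_of_nonneg {p : ℕ → ℝ} (hp : ∀ k, 0 ≤ p k) (hs : Summable p)
    {s : ℝ} (h0 : 0 ≤ s) (h1 : s ≤ 1) : Summable fun k => p k * s ^ k :=
  hs.of_nonneg_of_le (fun k => mul_nonneg (hp k) (pow_nonneg h0 k))
    fun k => mul_le_of_le_one_right (hp k) (pow_le_one₀ h0 h1)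

theorem mul_pgf_le_mul_pgf {p : ℕ → ℝ} (hp : ∀ k, 0 ≤ p k) (hp0 : p 0 = 0) (hs : Summable p)
    {s t : ℝ} (h0 : 0 ≤ s) (hst : s ≤ t) (h1 : t ≤ 1) : t * pgf p s ≤ s * pgf p t := by
  unfold pgf
  rw [← tsum_mul_left, ← tsum_mul_left]
  refine Summable.tsum_le_tsum (fun k => ?_)
    ((summable_mul_pow_of_nonneg hp hs h0 (hst.trans h1)).mul_left _)
    ((summable_mul_pow_of_nonneg hp hs (h0.trans hst) h1).mul_left _)
  cases k with
  | zero => simp [hp0]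
  | succ k =>
    have h : s ^ k ≤ t ^ k := pow_le_pow_left₀ h0 hst k
    have := mul_le_mul_of_nonneg_left h
      (mul_nonneg (hp (k + 1)) (mul_nonneg h0 (h0.trans hst)))
    rw [pow_succ, pow_succ]
    linarith

theorem one_sub_pow_mul_one_sub_le {s t : ℝ} (h0 : 0 ≤ s) (hst : s ≤ t) (h1 : t ≤ 1) (k : ℕ) :
    (1 - s ^ k) * (1 - t) ≤ (1 - t ^ k) * (1 - s) := by
  rw [← geom_sum_mul_neg, ← geom_sum_mul_neg]
  have h : ∑ i ∈ Finset.range k, s ^ i ≤ ∑ i ∈ Finset.range k, t ^ i :=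
    Finset.sum_le_sum fun i _ => pow_le_pow_left₀ h0 hst i
  have := mul_le_mul_of_nonneg_right h
    (mul_nonneg (sub_nonneg.2 (hst.trans h1)) (sub_nonneg.2 h1))
  linarith

theorem hasSum_one_sub_pgf {p : ℕ → ℝ} (hp : ∀ k, 0 ≤ p k) (hs : Summable p) (hsum : ∑' k, p k = 1)
    {s : ℝ} (h0 : 0 ≤ s) (h1 : s ≤ 1) : HasSum (fun k => p k * (1 - s ^ k)) (1 - pgf p s) := by
  have h := hs.hasSum.sub (summable_mul_pow_of_nonneg hp hs h0 h1).hasSum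
  rw [hsum] at h
  simpa only [pgf, mul_sub, mul_one] using h

theorem one_sub_pgf_mul_one_sub_le {p : ℕ → ℝ} (hp : ∀ k, 0 ≤ p k) (hs : Summable p)
    (hsum : ∑' k, p k = 1) {s t : ℝ} (h0 : 0 ≤ s) (hst : s ≤ t) (h1 : t ≤ 1) :
    (1 - pgf p s) * (1 - t) ≤ (1 - pgf p t) * (1 - s) := by
  refine hasSum_le (fun k => ?_)
    ((hasSum_one_sub_pgf hp hs hsum h0 (hst.trans h1)).mul_right (1 - t))
    ((hasSum_one_sub_pgf hp hs hsum (h0.trans hst) h1).mul_right (1 - s))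
  rw [mul_assoc, mul_assoc]
  exact mul_le_mul_of_nonneg_left (one_sub_pow_mul_one_sub_le h0 hst h1 k) (hp k)

theorem pgf_pos {p : ℕ → ℝ} (hp : ∀ k, 0 ≤ p k) (hs : Summable p) (hp1 : 0 < p 1)
    {s : ℝ} (h0 : 0 < s) (h1 : s ≤ 1) : 0 < pgf p s :=
  (summable_mul_pow_of_nonneg hp hs h0.le h1).tsum_pos
    (fun k => mul_nonneg (hp k) (pow_nonneg h0.le k)) 1 (by positivity)

theorem pgf_lt_self {p : ℕ → ℝ} (hp : ∀ k, 0 ≤ p k) (hp0 : p 0 = 0) (hs : Summable p)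
    (hsum : ∑' k, p k = 1) (hp1' : p 1 < 1) {s : ℝ} (h0 : 0 < s) (h1 : s < 1) :
    pgf p s < s := by
  have hle : pgf p s ≤ 1 * s ^ 2 + p 1 * (s - s ^ 2) := by
    have hR := (hs.hasSum.mul_right (s ^ 2)).add (hasSum_ite_eq 1 (p 1 * (s - s ^ 2)))
    rw [hsum] at hR
    refine hasSum_le (fun k => ?_)
      (summable_mul_pow_of_nonneg hp hs h0.le h1.le).hasSum hR
    match k with
    | 0 => simp [hp0]
    | 1 =>
      simp only [if_true]
      linarith
    | k + 2 =>
      simp only [Nat.reduceEqDiff, if_false, add_zero]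
      exact mul_le_mul_of_nonneg_left
        (pow_le_pow_of_le_one h0.le h1.le (Nat.le_add_left 2 k)) (hp _)
  nlinarith [mul_pos (sub_pos.2 hp1') (mul_pos h0 (sub_pos.2 h1))]

theorem le_pow_of_log_div_log_le {x c : ℝ} (hx : 0 < x) (hc : 1 < c) {n : ℕ}
    (h : Real.log x / Real.log c ≤ n) : x ≤ c ^ n := by
  rw [div_le_iff₀ (Real.log_pos hc), ← Real.log_pow] at h
  exact (Real.log_le_log_iff hx (pow_pos (zero_lt_one.trans hc) n)).1 h

theorem pathDepth_le_add_one {p : ℕ → ℝ} {α β x : ℝ} (hx : 0 ≤ x)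
    (h : ∀ n : ℕ, x ≤ n → (pgf p)^[n] β ≤ α) : (pathDepth p β α : ℝ) ≤ x + 1 :=
  (Nat.cast_le.2 (Nat.sInf_le (h ⌈x⌉₊ (Nat.le_ceil x)))).trans (Nat.ceil_lt_add_one hx).le

/-- Upper bound on the path depth `L_{β→α}`. -/
theorem stmt6 (p : ℕ → ℝ) (hp : ∀ k, 0 ≤ p k) (hp0 : p 0 = 0)
    (hp1 : 0 < p 1) (hp1' : p 1 < 1) (hsum : ∑' k, p k = 1)
    (α β : ℝ) (hα : 0 < α) (hαβ : α ≤ β) (hβ : β < 1) :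
    (pathDepth p β α : ℝ) ≤
      min (Real.log (β / α) / Real.log (β / pgf p β))
        (Real.log ((1 - α) / (1 - β)) / Real.log ((1 - pgf p α) / (1 - α))) + 1 := by
  have hs : Summable p := by
    by_contra h
    simp [tsum_eq_zero_of_not_summable h] at hsum
  have hβ0 : 0 < β := hα.trans_le hαβ
  have hα1 : α < 1 := hαβ.trans_lt hβ
  have hGβ := pgf_pos hp hs hp1 hβ0 hβ.le
  have hc₁ : 1 < β / pgf p β :=
    (one_lt_div hGβ).2 (pgf_lt_self hp hp0 hs hsum hp1' hβ0 hβ)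
  have hc₂ : 1 < (1 - pgf p α) / (1 - α) :=
    (one_lt_div (sub_pos.2 hα1)).2
      (sub_lt_sub_left (pgf_lt_self hp hp0 hs hsum hp1' hα hα1) 1)
  have hmem : ∀ n : ℕ, 0 < (pgf p)^[n] β ∧ (pgf p)^[n] β ≤ β := by
    intro n
    induction n with
    | zero => exact ⟨hβ0, le_rfl⟩
    | succ n ih =>
      rw [Function.iterate_succ_apply']
      have h1 := ih.2.trans_lt hβ
      exact ⟨pgf_pos hp hs hp1 ih.1 h1.le,
        (pgf_lt_self hp hp0 hs hsum hp1' ih.1 h1).le.trans ih.2⟩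
  rw [← min_add_add_right, le_min_iff]
  constructor
  · refine pathDepth_le_add_one
      (div_nonneg (Real.log_nonneg ((one_le_div hα).2 hαβ)) (Real.log_pos hc₁).le) fun n hn => ?_
    have hdecay : ∀ n : ℕ, (β / pgf p β) ^ n * (pgf p)^[n] β ≤ β := by
      intro n
      induction n with
      | zero => simp
      | succ n ih =>
        rw [Function.iterate_succ_apply', pow_succ, mul_assoc]
        refine (mul_le_mul_of_nonneg_left ?_ (pow_nonneg (by positivity) n)).trans ih
        rw [div_mul_eq_mul_div, div_le_iff₀ hGβ]
        exact mul_pgf_le_mul_pgf hp hp0 hs (hmem n).1.le (hmem n).2 hβ.le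
    have hpow := le_pow_of_log_div_log_le (div_pos hβ0 hα) hc₁ hn
    have h := (mul_le_mul_of_nonneg_right hpow (hmem n).1.le).trans (hdecay n)
    rw [div_mul_eq_mul_div, div_le_iff₀ hα] at h
    exact le_of_mul_le_mul_left h hβ0
  · refine pathDepth_le_add_one
      (div_nonneg (Real.log_nonneg ((one_le_div (sub_pos.2 hβ)).2 (by linarith)))
        (Real.log_pos hc₂).le) fun n hn => ?_
    have hgrowth : ∀ n : ℕ, α < (pgf p)^[n] β →
        ((1 - pgf p α) / (1 - α)) ^ n * (1 - β) ≤ 1 - (pgf p)^[n] β := by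
      intro n
      induction n with
      | zero => simp
      | succ n ih =>
        rw [Function.iterate_succ_apply']
        intro hlt
        have h1 := (hmem n).2.trans_lt hβ
        have hlt' := hlt.trans (pgf_lt_self hp hp0 hs hsum hp1' (hmem n).1 h1)
        rw [pow_succ', mul_assoc]
        refine (mul_le_mul_of_nonneg_left (ih hlt') (zero_le_one.trans hc₂.le)).trans ?_
        rw [div_mul_eq_mul_div, div_le_iff₀ (sub_pos.2 hα1)]
        exact one_sub_pgf_mul_one_sub_le hp hs hsum hα.le hlt'.le h1.le
    by_contra! hlt
    have hpow := le_pow_of_log_div_log_le (div_pos (sub_pos.2 hα1) (sub_pos.2 hβ)) hc₂ hn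
    rw [div_le_iff₀ (sub_pos.2 hβ)] at hpow
    linarith [hgrowth n hlt]
end

section
/- Let d ≥ 3 and 0 < r ≤ 1. Then: (a) there exists an r-polarized packing X ⊆ S^{d−1} with cardinality at least (1/(3r))^{d−1}; (b) every r-polarized packing X ⊆ S^{d−1} is finite with cardinality at most (3/r)^d. In particular, the polarized packing number satisfies (1/(3r))^{d−1} ≤ P_r(S^{d−1}) ≤ (3/r)^d. -/
/-- `X` is an `r`-polarized packing of the unit sphere of `ℝ^d`: `X` lies on the sphere and
for all distinct `x, y ∈ X` both `‖x - y‖ > r` and `‖x + y‖ > r`. -/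
def IsPolarizedPacking (d : ℕ) (r : ℝ) (X : Set (EuclideanSpace ℝ (Fin d))) : Prop :=
  X ⊆ Metric.sphere (0 : EuclideanSpace ℝ (Fin d)) 1 ∧
    ∀ x ∈ X, ∀ y ∈ X, x ≠ y → r < ‖x - y‖ ∧ r < ‖x + y‖

/-- The polarized packing number `P_r(S^{d-1})`: the maximal cardinality of an
`r`-polarized packing of the unit sphere. -/
noncomputable def polarizedPackingNumber (d : ℕ) (r : ℝ) : ℕ :=
  sSup {n : ℕ | ∃ X, IsPolarizedPacking d r X ∧ X.Finite ∧ Nat.card X = n}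

open MeasureTheory Metric

/-- Volume upper bound for finite separated subsets of the unit sphere. -/
theorem card_le_of_separated_sphere {d : ℕ} {r : ℝ} (hr0 : 0 < r) (hr1 : r ≤ 1)
    (s : Finset (EuclideanSpace ℝ (Fin d)))
    (hs : ∀ x ∈ s, ‖x‖ = 1) (hsep : ∀ x ∈ s, ∀ y ∈ s, x ≠ y → r < ‖x - y‖) :
    (s.card : ℝ) ≤ (3 / r) ^ d := by
  set v : ℝ := volume.real (ball (0 : EuclideanSpace ℝ (Fin d)) 1) with hv
  have hvpos : 0 < v :=
    ENNReal.toReal_pos (measure_ball_pos volume _ one_pos).ne' measure_ball_lt_top.ne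
  have hball : ∀ (x : EuclideanSpace ℝ (Fin d)) {t : ℝ}, 0 < t →
      volume.real (ball x t) = t ^ d * v := fun x t ht => by
    simp [hv, measureReal_def, Measure.addHaar_ball_of_pos volume x ht, ht.le]
  have hdisj : (s : Set (EuclideanSpace ℝ (Fin d))).PairwiseDisjoint
      fun x => ball x (r / 2) := by
    intro x hx y hy hxy
    refine ball_disjoint_ball ?_
    rw [dist_eq_norm]
    linarith [hsep x hx y hy hxy]
  have hsub : (⋃ x ∈ s, ball x (r / 2)) ⊆ ball 0 (3 / 2) := by
    refine Set.iUnion₂_subset fun x hx => ball_subset_ball' ?_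
    rw [dist_zero_right, hs x hx]
    linarith
  have hle := measureReal_mono hsub (μ := volume) measure_ball_lt_top.ne
  rw [measureReal_biUnion_finset hdisj (fun _ _ => measurableSet_ball)
      (fun _ _ => measure_ball_lt_top.ne),
    hball 0 (by norm_num), Finset.sum_congr rfl fun x _ => hball x (half_pos hr0),
    Finset.sum_const, nsmul_eq_mul, ← mul_assoc] at hle
  have h := le_of_mul_le_mul_right hle hvpos
  rw [show 3 / r = 3 / 2 / (r / 2) by field_simp, div_pow, le_div_iff₀ (by positivity)]
  exact h

/-- Volume lower bound for finite subsets of the sphere whose symmetrization is an `r`-net. -/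
theorem le_card_of_sphere_subset_cover {d : ℕ} {r : ℝ} (hr0 : 0 < r) (hr1 : r ≤ 1)
    (s : Finset (EuclideanSpace ℝ (Fin d)))
    (hs : ∀ x : EuclideanSpace ℝ (Fin d), ‖x‖ = 1 → ∃ y ∈ s, ‖x - y‖ ≤ r ∨ ‖x + y‖ ≤ r) :
    d * r ≤ 2 * s.card * (2 * r) ^ d := by
  set v : ℝ := volume.real (ball (0 : EuclideanSpace ℝ (Fin d)) 1) with hv
  have hvpos : 0 < v :=
    ENNReal.toReal_pos (measure_ball_pos volume _ one_pos).ne' measure_ball_lt_top.ne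
  have hcball : ∀ (x : EuclideanSpace ℝ (Fin d)) {t : ℝ}, 0 ≤ t →
      volume.real (closedBall x t) = t ^ d * v := fun x t ht => by
    simpa using Measure.addHaar_real_closedBall volume x ht
  have hcover : closedBall (0 : EuclideanSpace ℝ (Fin d)) (1 + r) ⊆
      closedBall 0 (1 - r) ∪ ⋃ y ∈ s, closedBall y (2 * r) ∪ closedBall (-y) (2 * r) := by
    intro z hz
    rw [mem_closedBall_zero_iff] at hz
    by_cases hz' : ‖z‖ ≤ 1 - r
    · exact Or.inl (by simpa using hz')
    push Not at hz'
    have hzpos : 0 < ‖z‖ := by linarith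
    set x := ‖z‖⁻¹ • z with hx
    have hx1 : ‖x‖ = 1 := by
      rw [hx, norm_smul, norm_inv, norm_norm, inv_mul_cancel₀ hzpos.ne']
    have hzx : ‖z - x‖ ≤ r := by
      have : z - x = (‖z‖ - 1) • x := by
        rw [sub_smul, one_smul, hx, smul_inv_smul₀ hzpos.ne']
      rw [this, norm_smul, hx1, mul_one, Real.norm_eq_abs, abs_le]
      constructor <;> linarith
    obtain ⟨y, hy, h⟩ := hs x hx1
    refine Or.inr (Set.mem_iUnion₂.2 ⟨y, hy, ?_⟩)
    refine h.imp (fun h => ?_) fun h => ?_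
    · rw [mem_closedBall_iff_norm, ← sub_add_sub_cancel z x y]
      linarith [norm_add_le (z - x) (x - y)]
    · rw [mem_closedBall_iff_norm, sub_neg_eq_add, ← sub_add_add_cancel z y x, add_comm y x]
      linarith [norm_add_le (z - x) (x + y)]
  have hunion : volume.real (⋃ y ∈ s, closedBall y (2 * r) ∪ closedBall (-y) (2 * r)) ≤
      s.card * (2 * ((2 * r) ^ d * v)) := by
    refine (measureReal_biUnion_finset_le _ _).trans ?_
    rw [← nsmul_eq_mul]
    refine Finset.sum_le_card_nsmul _ _ _ fun y _ => (measureReal_union_le _ _).trans ?_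
    rw [hcball _ (by positivity), hcball _ (by positivity), two_mul ((2 * r) ^ d * v)]
  have hfin : volume (closedBall (0 : EuclideanSpace ℝ (Fin d)) (1 - r) ∪
      ⋃ y ∈ s, closedBall y (2 * r) ∪ closedBall (-y) (2 * r)) ≠ ⊤ := by
    refine IsCompact.measure_ne_top ((isCompact_closedBall _ _).union ?_)
    exact s.isCompact_biUnion fun y _ =>
      (isCompact_closedBall _ _).union (isCompact_closedBall _ _)
  have hle := (measureReal_mono hcover hfin).trans (measureReal_union_le _ _)
  rw [hcball 0 (by linarith), hcball 0 (by linarith)] at hle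
  have hmul : (1 + r) ^ d * v ≤ ((1 - r) ^ d + 2 * s.card * (2 * r) ^ d) * v := by
    linarith
  have h := le_of_mul_le_mul_right hmul hvpos
  have hlow : 1 + d * r ≤ (1 + r) ^ d := one_add_mul_le_pow (by linarith) d
  have hup : (1 - r) ^ d ≤ 1 := pow_le_one₀ (by linarith) (by linarith)
  linarith

theorem two_pow_le_three_pow_pred {d : ℕ} (hd : 3 ≤ d) : (2 : ℝ) ^ d ≤ 3 ^ (d - 1) := by
  induction d, hd using Nat.le_induction with
  | base => norm_num
  | succ n hn ih =>
    obtain ⟨m, rfl⟩ : ∃ m, n = m + 1 := ⟨n - 1, by omega⟩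
    simp only [Nat.add_sub_cancel] at ih ⊢
    rw [pow_succ, pow_succ (3 : ℝ)]
    exact mul_le_mul ih (by norm_num) (by norm_num) (by positivity)

namespace IsPolarizedPacking

variable {d : ℕ} {r : ℝ} {X : Set (EuclideanSpace ℝ (Fin d))}

theorem finite_and_card_le (hr0 : 0 < r) (hr1 : r ≤ 1) (hX : IsPolarizedPacking d r X) :
    X.Finite ∧ (Nat.card X : ℝ) ≤ (3 / r) ^ d := by
  have hbound : ∀ s : Finset (EuclideanSpace ℝ (Fin d)), (s : Set _) ⊆ X →
      (s.card : ℝ) ≤ (3 / r) ^ d := fun s hs =>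
    card_le_of_separated_sphere hr0 hr1 s (fun x hx => by simpa using hX.1 (hs hx))
      fun x hx y hy hxy => (hX.2 x (hs hx) y (hs hy) hxy).1
  have hfin : X.Finite := by
    by_contra hinf
    obtain ⟨n, hn⟩ := exists_nat_gt ((3 / r) ^ d)
    obtain ⟨s, hs, hcard⟩ := Set.Infinite.exists_subset_card_eq hinf n
    have := hbound s hs
    rw [hcard] at this
    linarith
  refine ⟨hfin, ?_⟩
  rw [Nat.card_eq_card_finite_toFinset hfin]
  exact hbound _ (by simp)

theorem insert (hX : IsPolarizedPacking d r X) {x : EuclideanSpace ℝ (Fin d)} (hx : ‖x‖ = 1)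
    (h : ∀ y ∈ X, r < ‖x - y‖ ∧ r < ‖x + y‖) : IsPolarizedPacking d r (insert x X) := by
  refine ⟨Set.insert_subset (by simpa using hx) hX.1, ?_⟩
  rintro a (rfl | ha) b (rfl | hb) hab
  · exact absurd rfl hab
  · exact h b hb
  · rw [norm_sub_rev, add_comm]
    exact h a ha
  · exact hX.2 a ha b hb hab

/-- A polarized packing of maximal cardinality is a net of the sphere up to sign. -/
theorem exists_near_of_card_max (hr0 : 0 < r) (hX : IsPolarizedPacking d r X) (hfin : X.Finite)
    (hmax : ∀ Y, IsPolarizedPacking d r Y → Y.Finite → Nat.card Y ≤ Nat.card X)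
    {x : EuclideanSpace ℝ (Fin d)} (hx : ‖x‖ = 1) :
    ∃ y ∈ X, ‖x - y‖ ≤ r ∨ ‖x + y‖ ≤ r := by
  by_contra! h
  have hxX : x ∉ X := fun hmem => by
    have := (h x hmem).1
    rw [sub_self, norm_zero] at this
    linarith
  have hle := hmax _ (hX.insert hx h) (hfin.insert x)
  rw [Nat.card_coe_set_eq, Nat.card_coe_set_eq, Set.ncard_insert_of_notMem hxX hfin] at hle
  omega

end IsPolarizedPacking

theorem bddAbove_card_polarizedPacking (d : ℕ) {r : ℝ} (hr0 : 0 < r) (hr1 : r ≤ 1) :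
    BddAbove {n : ℕ | ∃ X, IsPolarizedPacking d r X ∧ X.Finite ∧ Nat.card X = n} := by
  refine ⟨⌊(3 / r) ^ d⌋₊, ?_⟩
  rintro n ⟨X, hX, -, rfl⟩
  exact Nat.le_floor (hX.finite_and_card_le hr0 hr1).2

theorem exists_card_eq_polarizedPackingNumber (d : ℕ) {r : ℝ} (hr0 : 0 < r) (hr1 : r ≤ 1) :
    ∃ X, IsPolarizedPacking d r X ∧ X.Finite ∧ Nat.card X = polarizedPackingNumber d r :=
  Nat.sSup_mem (s := {n : ℕ | ∃ X, IsPolarizedPacking d r X ∧ X.Finite ∧ Nat.card X = n})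
    ⟨0, ∅, ⟨Set.empty_subset _, by simp⟩, Set.finite_empty, by simp⟩
    (bddAbove_card_polarizedPacking d hr0 hr1)

theorem le_polarizedPackingNumber {d : ℕ} (hd : 3 ≤ d) {r : ℝ} (hr0 : 0 < r) (hr1 : r ≤ 1) :
    (1 / (3 * r)) ^ (d - 1) ≤ (polarizedPackingNumber d r : ℝ) := by
  obtain ⟨X, hX, hfin, hcard⟩ := exists_card_eq_polarizedPackingNumber d hr0 hr1
  have hnet := le_card_of_sphere_subset_cover hr0 hr1 hfin.toFinset fun x hx => by
    simpa using hX.exists_near_of_card_max hr0 hfin (fun Y hY hYfin => hcard ▸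
      le_csSup (bddAbove_card_polarizedPacking d hr0 hr1) ⟨Y, hY, hYfin, rfl⟩) hx
  rw [← Nat.card_eq_card_finite_toFinset hfin, hcard] at hnet
  set N : ℝ := (polarizedPackingNumber d r : ℝ)
  have hN : 0 ≤ N := Nat.cast_nonneg _
  have hd' : (3 : ℝ) ≤ d := by exact_mod_cast hd
  have hrd : r ^ d = r ^ (d - 1) * r := by rw [← pow_succ]; congr 1; omega
  have hmul : 1 * r ≤ N * (2 ^ d * r ^ (d - 1)) * r := by
    rw [mul_pow, hrd] at hnet
    nlinarith
  have h1 := le_of_mul_le_mul_right hmul hr0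
  rw [one_div, inv_pow, inv_le_iff_one_le_mul₀ (by positivity), mul_pow]
  refine h1.trans ?_
  gcongr
  exact two_pow_le_three_pow_pred hd

/-- Polarized metric entropy of the sphere: (a) there exists an `r`-polarized packing of
cardinality at least `(1/(3r))^{d-1}`; (b) every `r`-polarized packing is finite with
cardinality at most `(3/r)^d`; in particular `(1/(3r))^{d-1} ≤ P_r(S^{d-1}) ≤ (3/r)^d`. -/
theorem stmt12 (d : ℕ) (hd : 3 ≤ d) (r : ℝ) (hr0 : 0 < r) (hr1 : r ≤ 1) :
    (∃ X : Set (EuclideanSpace ℝ (Fin d)), IsPolarizedPacking d r X ∧ X.Finite ∧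
      (1 / (3 * r)) ^ (d - 1) ≤ (Nat.card X : ℝ)) ∧
    (∀ X : Set (EuclideanSpace ℝ (Fin d)), IsPolarizedPacking d r X →
      X.Finite ∧ (Nat.card X : ℝ) ≤ (3 / r) ^ d) ∧
    ((1 / (3 * r)) ^ (d - 1) ≤ (polarizedPackingNumber d r : ℝ) ∧
      (polarizedPackingNumber d r : ℝ) ≤ (3 / r) ^ d) := by
  have hlow := le_polarizedPackingNumber hd hr0 hr1
  obtain ⟨X, hX, hfin, hcard⟩ := exists_card_eq_polarizedPackingNumber d hr0 hr1
  refine ⟨⟨X, hX, hfin, hcard ▸ hlow⟩, fun Y hY => hY.finite_and_card_le hr0 hr1, hlow, ?_⟩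
  rw [← hcard]
  exact (hX.finite_and_card_le hr0 hr1).2
end
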